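/- arXiv:1904.13262 — 9 statements merged into one kernel-verified Lean document; each statement's English description precedes it below -/
import Mathlib

section
/- Let σ > 0, λ ≥ 0, δ ∈ ℝ, and define w(t) := σ·e^{2σt − 2δ} / (λ·(e^{2σt − 2δ} − e^{−2δ}) + σ) for t ≥ 0. Then the functions m(t) := √(w(t)) and n(t) := √(w(t)) satisfy m(0) = n(0) = e^{−δ} and the coupled system of scalar differential equations ṁ(t) = n(t)·(σ − λ·m(t)·n(t)) and ṅ(t) = m(t)·(σ − λ·m(t)·n(t)) for all t ≥ 0. -/
/-- The quotient `σf/(λ(f − c) + σ)` with `f' = 2σf` solves the logistic equation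
`w' = 2w(σ − λw)` wherever its denominator does not vanish. -/
theorem hasDerivAt_logistic_quotient {σ lam c t : ℝ} {f : ℝ → ℝ}
    (hf : HasDerivAt f (2 * σ * f t) t) (hD : lam * (f t - c) + σ ≠ 0) :
    HasDerivAt (fun s => σ * f s / (lam * (f s - c) + σ))
      (2 * (σ * f t / (lam * (f t - c) + σ)) *
        (σ - lam * (σ * f t / (lam * (f t - c) + σ)))) t := by
  refine ((hf.const_mul σ).fun_div (((hf.sub_const c).const_mul lam).add_const σ) hD).congr_deriv ?_
  field_simp

/-- The square root of a positive solution of `w' = 2w(σ − λw)` solves `u' = u(σ − λu²)`. -/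
theorem HasDerivAt.sqrt_of_logistic {σ lam t : ℝ} {w : ℝ → ℝ}
    (hw : HasDerivAt w (2 * w t * (σ - lam * w t)) t) (hpos : 0 < w t) :
    HasDerivAt (fun s => √(w s)) (√(w t) * (σ - lam * √(w t) * √(w t))) t := by
  refine (hw.sqrt hpos.ne').congr_deriv ?_
  have hs : 0 < √(w t) := Real.sqrt_pos.2 hpos
  have hsq : w t = √(w t) ^ 2 := (Real.sq_sqrt hpos.le).symm
  generalize √(w t) = u at hs hsq ⊢
  rw [hsq]
  field_simp

/-- With `w(t) = σe^{2σt − 2δ}/(λ(e^{2σt − 2δ} − e^{−2δ}) + σ)`, the functions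
`m = n = √w` satisfy `m(0) = n(0) = e^{−δ}` and the coupled system
`ṁ = n(σ − λmn)`, `ṅ = m(σ − λmn)` for all `t ≥ 0`. -/
theorem stmt_6 (σ lam δ : ℝ) (hσ : 0 < σ) (hlam : 0 ≤ lam)
    (w m n : ℝ → ℝ)
    (hw : ∀ t : ℝ, w t = σ * Real.exp (2 * σ * t - 2 * δ) /
      (lam * (Real.exp (2 * σ * t - 2 * δ) - Real.exp (-2 * δ)) + σ))
    (hm : ∀ t : ℝ, m t = Real.sqrt (w t))
    (hn : ∀ t : ℝ, n t = Real.sqrt (w t)) :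
    m 0 = Real.exp (-δ) ∧ n 0 = Real.exp (-δ) ∧
    ∀ t : ℝ, 0 ≤ t →
      HasDerivAt m (n t * (σ - lam * m t * n t)) t ∧
      HasDerivAt n (m t * (σ - lam * m t * n t)) t := by
  obtain rfl : m = fun t => √(w t) := funext hm
  obtain rfl : n = fun t => √(w t) := funext hn
  have h_init : √(w 0) = Real.exp (-δ) := by
    have hw0 : w 0 = Real.exp (-δ) ^ 2 := by
      rw [hw, ← Real.exp_nat_mul]
      have hexp : 2 * σ * 0 - 2 * δ = -2 * δ := by ring
      rw [hexp, sub_self, mul_zero, zero_add, mul_div_cancel_left₀ _ hσ.ne']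
      congr 1
      push_cast
      ring
    rw [hw0, Real.sqrt_sq (Real.exp_pos _).le]
  have h_deriv (t : ℝ) (ht : 0 ≤ t) :
      HasDerivAt (fun s => √(w s)) (√(w t) * (σ - lam * √(w t) * √(w t))) t := by
    have hexp : HasDerivAt (fun s => Real.exp (2 * σ * s - 2 * δ))
        (2 * σ * Real.exp (2 * σ * t - 2 * δ)) t := by
      refine (((hasDerivAt_id t).const_mul (2 * σ)).sub_const (2 * δ)).exp.congr_deriv ?_
      simp [mul_comm]
    have hD : 0 < lam * (Real.exp (2 * σ * t - 2 * δ) - Real.exp (-2 * δ)) + σ := by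
      have hle : Real.exp (-2 * δ) ≤ Real.exp (2 * σ * t - 2 * δ) :=
        Real.exp_le_exp.2 (by linarith [mul_nonneg hσ.le ht])
      linarith [mul_nonneg hlam (sub_nonneg.2 hle)]
    have hpos : 0 < w t := by
      rw [hw]
      exact div_pos (mul_pos hσ (Real.exp_pos _)) hD
    refine HasDerivAt.sqrt_of_logistic ?_ hpos
    rw [hw t, funext hw]
    exact hasDerivAt_logistic_quotient hexp hD.ne'
  exact ⟨h_init, h_init, fun t ht => ⟨h_deriv t ht, h_deriv t ht⟩⟩
end

section
/- Let σ > 0 and λ > 0, and for δ > 0 define w_δ(t) := σ·e^{2δ(σt − 1)} / (λ·(e^{2δ(σt − 1)} − e^{−2δ}) + σ). Then as δ → ∞: (1) w_δ(t) → 0 for every fixed t with 0 ≤ t < 1/σ; (2) w_δ(1/σ) → σ/(λ + σ); and (3) w_δ(t) → σ/λ for every fixed t > 1/σ. Moreover, for λ > 0 the function v_δ(t) := e^{−2δ} / (1 + 2·e^{−2δ}·λ·δ·t) satisfies v_δ(t) → 0 as δ → ∞ for every fixed t ≥ 0. -/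
open Filter

/-- `exp (c * x) → 0` as `x → ∞` when `c < 0`. -/
theorem tendsto_exp_const_mul_atTop_of_neg {c : ℝ} (hc : c < 0) :
    Tendsto (fun x : ℝ => Real.exp (c * x)) atTop (nhds 0) :=
  Real.tendsto_exp_atBot.comp (tendsto_id.const_mul_atTop_of_neg hc)

/-- Theorem 2 (sequential learning): with
`w_δ(t) = σe^{2δ(σt−1)}/(λ(e^{2δ(σt−1)} − e^{−2δ}) + σ)`, as `δ → ∞`,
`w_δ(t) → 0` for `0 ≤ t < 1/σ`, `w_δ(1/σ) → σ/(λ+σ)`, and `w_δ(t) → σ/λ` for `t > 1/σ`;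
moreover `v_δ(t) = e^{−2δ}/(1 + 2e^{−2δ}λδt) → 0` for every fixed `t ≥ 0`. -/
theorem stmt_8 (σ lam : ℝ) (hσ : 0 < σ) (hlam : 0 < lam)
    (w v : ℝ → ℝ → ℝ)
    (hw : ∀ δ t : ℝ, w δ t = σ * Real.exp (2 * δ * (σ * t - 1)) /
      (lam * (Real.exp (2 * δ * (σ * t - 1)) - Real.exp (-2 * δ)) + σ))
    (hv : ∀ δ t : ℝ, v δ t = Real.exp (-2 * δ) /
      (1 + 2 * Real.exp (-2 * δ) * lam * δ * t)) :
    (∀ t : ℝ, 0 ≤ t → t < 1 / σ →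
        Tendsto (fun δ : ℝ => w δ t) atTop (nhds 0)) ∧
    Tendsto (fun δ : ℝ => w δ (1 / σ)) atTop (nhds (σ / (lam + σ))) ∧
    (∀ t : ℝ, 1 / σ < t →
        Tendsto (fun δ : ℝ => w δ t) atTop (nhds (σ / lam))) ∧
    (∀ t : ℝ, 0 ≤ t → Tendsto (fun δ : ℝ => v δ t) atTop (nhds 0)) := by
  have hdecay : Tendsto (fun δ : ℝ => Real.exp (-2 * δ)) atTop (nhds 0) :=
    tendsto_exp_const_mul_atTop_of_neg (by norm_num)
  refine ⟨fun t _ ht => ?_, ?_, fun t ht => ?_, fun t ht => ?_⟩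
  · have hneg : 2 * (σ * t - 1) < 0 := by
      rw [lt_div_iff₀ hσ] at ht
      linarith
    have hexp := tendsto_exp_const_mul_atTop_of_neg hneg
    have hlim := (hexp.const_mul σ).div
      (((hexp.sub hdecay).const_mul lam).add_const σ) (by simpa using hσ.ne')
    simp only [mul_zero, zero_div] at hlim
    refine hlim.congr fun δ => ?_
    simp only [hw, Pi.div_apply]
    rw [show 2 * δ * (σ * t - 1) = 2 * (σ * t - 1) * δ by ring]
  · have hlim := (tendsto_const_nhds (x := σ)).div
      (((hdecay.const_sub 1).const_mul lam).add_const σ) (by rw [sub_zero, mul_one]; positivity)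
    simp only [sub_zero, mul_one] at hlim
    refine hlim.congr fun δ => ?_
    simp only [hw, Pi.div_apply]
    rw [mul_one_div_cancel hσ.ne']
    simp
  · have hneg : -(2 * (σ * t - 1)) < 0 := by
      rw [div_lt_iff₀ hσ] at ht
      linarith
    have hexp := tendsto_exp_const_mul_atTop_of_neg hneg
    have hlim := (tendsto_const_nhds (x := σ)).div
      ((((hdecay.mul hexp).const_sub 1).const_mul lam).add (hexp.const_mul σ))
      (by simpa using hlam.ne')
    simp only [mul_zero, sub_zero, mul_one, add_zero] at hlim
    refine hlim.congr fun δ => ?_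
    simp only [hw, Pi.div_apply]
    rw [show -(2 * (σ * t - 1)) * δ = -(2 * δ * (σ * t - 1)) by ring,
      Real.exp_neg (2 * δ * (σ * t - 1)),
      ← mul_div_mul_right σ _ (Real.exp_pos (2 * δ * (σ * t - 1))).ne']
    congr 1
    field_simp
  · refine tendsto_of_tendsto_of_tendsto_of_le_of_le' tendsto_const_nhds hdecay ?_ ?_ <;>
      filter_upwards [eventually_ge_atTop 0] with δ hδ <;> rw [hv]
    · positivity
    · exact div_le_self (Real.exp_pos _).le (le_add_of_nonneg_right (by positivity))
end

section
/- Let r ≥ 1, let σ₁ > σ₂ > … > σ_r > 0 and λ₁, …, λ_r > 0, and for δ > 0 and 1 ≤ i ≤ r define w_{δ,i}(t) := σᵢ·e^{2δ(σᵢt − 1)} / (λᵢ·(e^{2δ(σᵢt − 1)} − e^{−2δ}) + σᵢ). Then for every fixed t ≥ 0, the sum Σ_{i=1}^{r} w_{δ,i}(t)² converges, as δ → ∞, to Σ_{i=1}^{r} [ (σᵢ²/λᵢ²)·1{1/σᵢ < t} + (σᵢ²/(λᵢ + σᵢ)²)·1{1/σᵢ = t} ], where 1{·} denotes the indicator of the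 stated condition. -/
open Filter

/-- If `E → c` and `e → 0`, the logistic quotient `s E / (l (E - e) + s)` tends to its value at
`(c, 0)`. -/
lemma tendsto_logistic_of_tendsto {α : Type*} {f : Filter α} {E e : α → ℝ} {s l c : ℝ}
    (hne : l * c + s ≠ 0) (hE : Tendsto E f (nhds c)) (he : Tendsto e f (nhds 0)) :
    Tendsto (fun x => s * E x / (l * (E x - e x) + s)) f (nhds (s * c / (l * c + s))) := by
  have hden : Tendsto (fun x => l * (E x - e x) + s) f (nhds (l * c + s)) := by
    simpa using ((hE.sub he).const_mul l).add_const s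
  exact (hE.const_mul s).div hden hne

/-- If `E → ∞` and `e → 0`, the logistic quotient `s E / (l (E - e) + s)` tends to `s / l`. -/
lemma tendsto_logistic_of_tendsto_atTop {α : Type*} {f : Filter α} {E e : α → ℝ} {s l : ℝ}
    (hl : l ≠ 0) (hE : Tendsto E f atTop) (he : Tendsto e f (nhds 0)) :
    Tendsto (fun x => s * E x / (l * (E x - e x) + s)) f (nhds (s / l)) := by
  have hinv : Tendsto (fun x => (E x)⁻¹) f (nhds 0) := tendsto_inv_atTop_zero.comp hE
  have hden : Tendsto (fun x => l * (1 - e x * (E x)⁻¹) + s * (E x)⁻¹) f (nhds l) := by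
    simpa using (((he.mul hinv).const_sub 1).const_mul l).add (hinv.const_mul s)
  refine (tendsto_const_nhds.div hden hl).congr' ?_
  filter_upwards [hE.eventually_gt_atTop 0] with x hx
  have hfac : l * (E x - e x) + s = (l * (1 - e x * (E x)⁻¹) + s * (E x)⁻¹) * E x := by
    field_simp
  rw [Pi.div_apply, hfac, mul_div_mul_right _ _ hx.ne']

/-- The pointwise limit of a squared rescaled singular value is a step function of time. -/
lemma tendsto_rescaled_singular_value_sq {s l : ℝ} (hs : 0 < s) (hl : 0 < l) (t : ℝ) :
    Tendsto (fun δ : ℝ => (s * Real.exp (2 * δ * (s * t - 1)) /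
        (l * (Real.exp (2 * δ * (s * t - 1)) - Real.exp (-2 * δ)) + s)) ^ 2) atTop
      (nhds (s ^ 2 / l ^ 2 * (if 1 / s < t then 1 else 0)
        + s ^ 2 / (l + s) ^ 2 * (if 1 / s = t then 1 else 0))) := by
  have he : Tendsto (fun δ : ℝ => Real.exp (-2 * δ)) atTop (nhds 0) :=
    Real.tendsto_exp_atBot.comp (tendsto_id.const_mul_atTop_of_neg (by norm_num))
  have hlin : Tendsto (fun δ : ℝ => 2 * δ) atTop atTop :=
    tendsto_id.const_mul_atTop (by norm_num)
  rcases lt_trichotomy (1 / s) t with h | h | h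
  · have hpos : 0 < s * t - 1 := by
      rw [div_lt_iff₀ hs] at h
      linarith
    have hE := Real.tendsto_exp_atTop.comp (hlin.atTop_mul_const hpos)
    rw [if_pos h, if_neg h.ne]
    simpa [div_pow] using (tendsto_logistic_of_tendsto_atTop (s := s) hl.ne' hE he).pow 2
  · have hzero : s * t - 1 = 0 := by
      rw [← h, mul_one_div_cancel hs.ne', sub_self]
    have hE : Tendsto (fun δ : ℝ => Real.exp (2 * δ * (s * t - 1))) atTop (nhds 1) := by
      simp [hzero]
    have hlim := (tendsto_logistic_of_tendsto (s := s) (l := l) (by positivity) hE he).pow 2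
    rw [if_neg h.not_lt, if_pos h]
    simpa only [mul_one, mul_zero, zero_add, div_pow] using hlim
  · have hneg : s * t - 1 < 0 := by
      rw [lt_div_iff₀ hs] at h
      linarith
    have hE := Real.tendsto_exp_atBot.comp (hlin.atTop_mul_const_of_neg hneg)
    have hlim := (tendsto_logistic_of_tendsto (s := s) (l := l) (by simpa using hs.ne') hE he).pow 2
    rw [if_neg h.not_gt, if_neg h.ne']
    simpa using hlim

/-- Corollary 1: the squared Frobenius norm `∑ᵢ w_{δ,i}(t)²` of the time-rescaled
two-layer product converges, as `δ → ∞`, to the step function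
`∑ᵢ (σᵢ²/λᵢ²)·1{1/σᵢ < t} + (σᵢ²/(λᵢ+σᵢ)²)·1{1/σᵢ = t}`. -/
theorem stmt_9 (r : ℕ) (hr : 1 ≤ r) (σ lam : Fin r → ℝ)
    (hσpos : ∀ i, 0 < σ i)
    (hσdec : ∀ i j : Fin r, i < j → σ j < σ i)
    (hlam : ∀ i, 0 < lam i)
    (w : ℝ → Fin r → ℝ → ℝ)
    (hw : ∀ (δ : ℝ) (i : Fin r) (t : ℝ),
      w δ i t = σ i * Real.exp (2 * δ * (σ i * t - 1)) /
        (lam i * (Real.exp (2 * δ * (σ i * t - 1)) - Real.exp (-2 * δ)) + σ i))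
    (t : ℝ) (ht : 0 ≤ t) :
    Tendsto (fun δ : ℝ => ∑ i : Fin r, (w δ i t) ^ 2) atTop
      (nhds (∑ i : Fin r, (((σ i) ^ 2 / (lam i) ^ 2) * (if 1 / σ i < t then 1 else 0)
        + ((σ i) ^ 2 / (lam i + σ i) ^ 2) * (if 1 / σ i = t then 1 else 0)))) := by
  simp only [hw]
  exact tendsto_finsetSum _ fun i _ => tendsto_rescaled_singular_value_sq (hσpos i) (hlam i) t
end

section
/- Let U and V be orthogonal d×d real matrices, let σ₁ > σ₂ > … > σ_r > 0 with r ≤ d and σᵢ = 0 for r < i ≤ d, let λ₁, …, λ_d > 0, and for δ > 0 define w_{δ,i}(t) := σᵢ·e^{2δ(σᵢt − 1)} / (λᵢ·(e^{2δ(σᵢt − 1)} − e^{−2δ}) + σᵢ) for i ≤ r and w_{δ,i}(t) := e^{−2δ}/(1 + 2·e^{−2δ}·λᵢ·δ·t) for i > r. Fix 1 ≤ k ≤ r and t > 1/σ_k such that, if k < r, additionally t < 1/σ_{k+1}. Then the matrix U·diag(w_{δ,1}(t), …, w_{δ,d}(t))·Vᵀ converges, as δ → ∞, to U·diag(σ₁/λ₁,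 …, σ_k/λ_k, 0, …, 0)·Vᵀ = Σ_{i=1}^{k} (σᵢ/λᵢ)·uᵢ·vᵢᵀ, a matrix of rank exactly k (where uᵢ, vᵢ are the i-th columns of U, V). -/
open Matrix Filter

/-- The exponential `e^{-2x}` vanishes at infinity. -/
theorem tendsto_exp_neg_two_mul :
    Tendsto (fun x : ℝ => Real.exp (-2 * x)) atTop (nhds 0) :=
  Real.tendsto_exp_atBot.comp (tendsto_id.const_mul_atTop_of_neg (by norm_num))

/-- A mode whose transition time has passed converges to its least-squares value `s / l`. -/
theorem tendsto_mode_of_pos {s l c : ℝ} (hl : 0 < l) (hc : 0 < c) :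
    Tendsto (fun x : ℝ => s * Real.exp (2 * x * c) /
      (l * (Real.exp (2 * x * c) - Real.exp (-2 * x)) + s)) atTop (nhds (s / l)) := by
  have hinv : Tendsto (fun x : ℝ => Real.exp (-(2 * x * c))) atTop (nhds 0) := by
    refine Real.tendsto_exp_atBot.comp (tendsto_neg_atTop_atBot.comp ?_)
    exact (tendsto_id.const_mul_atTop two_pos).atTop_mul_const hc
  have hden : Tendsto (fun x : ℝ => l * (1 - Real.exp (-2 * x) * Real.exp (-(2 * x * c))) +
      s * Real.exp (-(2 * x * c))) atTop (nhds l) := by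
    simpa using (((tendsto_exp_neg_two_mul.mul hinv).const_sub 1).const_mul l).add
      (hinv.const_mul s)
  refine (tendsto_const_nhds.div hden hl.ne').congr fun x => ?_
  have hE := Real.exp_ne_zero (2 * x * c)
  rw [Pi.div_apply, Real.exp_neg, ← mul_div_mul_right _ _ hE]
  congr 1
  field_simp

/-- A mode whose transition time has not been reached converges to zero. -/
theorem tendsto_mode_of_neg {s l c : ℝ} (hs : s ≠ 0) (hc : c < 0) :
    Tendsto (fun x : ℝ => s * Real.exp (2 * x * c) /
      (l * (Real.exp (2 * x * c) - Real.exp (-2 * x)) + s)) atTop (nhds 0) := by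
  have hE : Tendsto (fun x : ℝ => Real.exp (2 * x * c)) atTop (nhds 0) :=
    Real.tendsto_exp_atBot.comp
      ((tendsto_id.const_mul_atTop two_pos).atTop_mul_const_of_neg hc)
  have hden : Tendsto (fun x : ℝ => l * (Real.exp (2 * x * c) - Real.exp (-2 * x)) + s)
      atTop (nhds s) := by
    simpa using ((hE.sub tendsto_exp_neg_two_mul).const_mul l).add_const s
  simpa [Pi.div_def] using (hE.const_mul s).div hden hs

/-- A mode with zero singular value converges to zero. -/
theorem tendsto_null_mode (l t : ℝ) :
    Tendsto (fun x : ℝ => Real.exp (-2 * x) / (1 + 2 * Real.exp (-2 * x) * l * x * t))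
      atTop (nhds 0) := by
  have hmul : Tendsto (fun x : ℝ => x * Real.exp (-2 * x)) atTop (nhds 0) := by
    have h := ((Real.tendsto_pow_mul_exp_neg_atTop_nhds_zero 1).comp
      (tendsto_id.const_mul_atTop two_pos)).const_mul (1 / 2)
    rw [mul_zero] at h
    refine h.congr fun x => ?_
    simp only [Function.comp_apply, id_eq, pow_one, neg_mul]
    ring
  have hden : Tendsto (fun x : ℝ => 1 + 2 * Real.exp (-2 * x) * l * x * t) atTop (nhds 1) := by
    have h := (hmul.const_mul (2 * l * t)).const_add 1
    rw [mul_zero, add_zero] at h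
    exact h.congr fun x => by ring
  simpa [Pi.div_def] using tendsto_exp_neg_two_mul.div hden one_ne_zero

/-- Expansion of `U * diagonal a * Vᵀ` as a sum of outer products of columns. -/
theorem mul_diagonal_mul_transpose_eq_sum {m n p : Type*} [Fintype m] [DecidableEq m]
    (U : Matrix n m ℝ) (V : Matrix p m ℝ) (a : m → ℝ) :
    U * Matrix.diagonal a * Vᵀ =
      ∑ i, a i • Matrix.vecMulVec (fun x => U x i) (fun y => V y i) := by
  ext x y
  rw [Matrix.mul_apply]
  simp only [Matrix.mul_diagonal, Matrix.sum_apply, Matrix.smul_apply,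
    Matrix.vecMulVec_apply, Matrix.transpose_apply, smul_eq_mul]
  exact Finset.sum_congr rfl fun i _ => by ring

/-- Corollary 2 (convergence part): between consecutive phase transitions
`1/σ_k < t < 1/σ_{k+1}` the time-rescaled product `U·diag(w_{δ,i}(t))·Vᵀ` converges,
as `δ → ∞`, to `U·diag(σ₁/λ₁,…,σ_k/λ_k,0,…,0)·Vᵀ = ∑_{i<k} (σᵢ/λᵢ)uᵢvᵢᵀ`,
a matrix of rank exactly `k`. (Indices are 0-based: `σ ⟨k-1⟩`, `σ ⟨k⟩` are the
`k`-th and `(k+1)`-th singular values in 1-based notation.) -/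
theorem stmt_10 (d r k : ℕ) (hrd : r ≤ d) (hk1 : 1 ≤ k) (hkr : k ≤ r)
    (U V : Matrix (Fin d) (Fin d) ℝ) (hU : Uᵀ * U = 1) (hV : Vᵀ * V = 1)
    (σ lam : Fin d → ℝ)
    (hσpos : ∀ i : Fin d, (i : ℕ) < r → 0 < σ i)
    (hσdec : ∀ i j : Fin d, (i : ℕ) < r → (j : ℕ) < r → i < j → σ j < σ i)
    (hσ0 : ∀ i : Fin d, r ≤ (i : ℕ) → σ i = 0)
    (hlam : ∀ i, 0 < lam i)
    (w : ℝ → Fin d → ℝ → ℝ)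
    (hw1 : ∀ (δ : ℝ) (i : Fin d) (t : ℝ), (i : ℕ) < r →
      w δ i t = σ i * Real.exp (2 * δ * (σ i * t - 1)) /
        (lam i * (Real.exp (2 * δ * (σ i * t - 1)) - Real.exp (-2 * δ)) + σ i))
    (hw2 : ∀ (δ : ℝ) (i : Fin d) (t : ℝ), r ≤ (i : ℕ) →
      w δ i t = Real.exp (-2 * δ) / (1 + 2 * Real.exp (-2 * δ) * lam i * δ * t))
    (t : ℝ)
    (ht1 : 1 / σ ⟨k - 1, by omega⟩ < t)
    (ht2 : ∀ _h : k < r, t < 1 / σ ⟨k, by omega⟩) :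
    Tendsto (fun δ : ℝ => U * Matrix.diagonal (fun i => w δ i t) * Vᵀ) atTop
      (nhds (U * Matrix.diagonal
        (fun i : Fin d => if (i : ℕ) < k then σ i / lam i else 0) * Vᵀ)) ∧
    U * Matrix.diagonal (fun i : Fin d => if (i : ℕ) < k then σ i / lam i else 0) * Vᵀ
      = ∑ i ∈ Finset.univ.filter (fun i : Fin d => (i : ℕ) < k),
          (σ i / lam i) • Matrix.vecMulVec (fun a => U a i) (fun b => V b i) ∧
    (U * Matrix.diagonal
        (fun i : Fin d => if (i : ℕ) < k then σ i / lam i else 0) * Vᵀ).rank = k := by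
  have hanti : ∀ i j : Fin d, (j : ℕ) < r → i ≤ j → σ j ≤ σ i := fun i j hj hij =>
    hij.eq_or_lt.elim (fun h => h ▸ le_rfl) fun h => (hσdec i j (by omega) hj h).le
  have hkpos : 0 < σ ⟨k - 1, by omega⟩ := hσpos _ (by simp only; omega)
  have ht : 0 < t := (one_div_pos.2 hkpos).trans ht1
  refine ⟨?_, ?_, ?_⟩
  · have hdiag : Tendsto (fun δ : ℝ => fun i => w δ i t) atTop
        (nhds fun i : Fin d => if (i : ℕ) < k then σ i / lam i else 0) := by
      refine tendsto_pi_nhds.2 fun i => ?_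
      by_cases hik : (i : ℕ) < k
      · have hle : σ ⟨k - 1, by omega⟩ ≤ σ i :=
          hanti i _ (by simp only; omega) (Fin.le_def.2 (by simp only; omega))
        have hc : 0 < σ i * t - 1 := by
          have h := (div_lt_iff₀' hkpos).1 ht1
          linarith [mul_le_mul_of_nonneg_right hle ht.le]
        simp only [if_pos hik, hw1 _ i t (hik.trans_le hkr)]
        exact tendsto_mode_of_pos (hlam i) hc
      · rw [if_neg hik]
        by_cases hir : (i : ℕ) < r
        · have hlt : k < r := by omega
          have hle : σ i ≤ σ ⟨k, by omega⟩ := hanti _ i hir (Fin.le_def.2 (by simp only; omega))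
          have hc : σ i * t - 1 < 0 := by
            have h := (lt_div_iff₀' (hσpos ⟨k, by omega⟩ hlt)).1 (ht2 hlt)
            linarith [mul_le_mul_of_nonneg_right hle ht.le]
          simp only [hw1 _ i t hir]
          exact tendsto_mode_of_neg (hσpos i hir).ne' hc
        · simp only [hw2 _ i t (not_lt.1 hir)]
          exact tendsto_null_mode _ _
    have hcont : Continuous fun a : Fin d → ℝ => U * Matrix.diagonal a * Vᵀ := by fun_prop
    exact (hcont.tendsto _).comp hdiag
  · rw [mul_diagonal_mul_transpose_eq_sum, Finset.sum_filter]
    exact Finset.sum_congr rfl fun i _ => by split_ifs <;> simp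
  · have hUdet : IsUnit U.det := (Matrix.isUnit_iff_isUnit_det U).1 (.of_mul_eq_one_right _ hU)
    have hVdet : IsUnit Vᵀ.det := (Matrix.isUnit_iff_isUnit_det Vᵀ).1 (.of_mul_eq_one _ hV)
    rw [Matrix.rank_mul_eq_left_of_isUnit_det _ _ hVdet,
      Matrix.rank_mul_eq_right_of_isUnit_det _ _ hUdet, Matrix.rank_diagonal]
    have hiff : ∀ i : Fin d, (if (i : ℕ) < k then σ i / lam i else 0) ≠ 0 ↔ (i : ℕ) < k := by
      intro i
      split_ifs with h
      · simpa [h] using ⟨(hσpos i (h.trans_le hkr)).ne', (hlam i).ne'⟩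
      · simp [h]
    rw [Fintype.card_congr (Equiv.subtypeEquivRight hiff),
      Fintype.card_congr (Fin.castLEquiv (hkr.trans hrd)).symm, Fintype.card_fin]
end

section
/- Let U, V, Q be orthogonal d×d real matrices, let λ₁, …, λ_d ≥ 0 and σ₁, …, σ_d ≥ 0 and δ₁, …, δ_d ∈ ℝ, and set Σx := U·diag(λ₁, …, λ_d)·Uᵀ and Σxy := U·diag(σ₁, …, σ_d)·Vᵀ. For each i define wᵢ(t) := σᵢ·e^{2σᵢt − 2δᵢ} / (λᵢ·(e^{2σᵢt − 2δᵢ} − e^{−2δᵢ}) + σᵢ) if σᵢ > 0, and wᵢ(t) := e^{−2δᵢ}/(1 + 2·e^{−2δᵢ}·λᵢ·t) if σᵢ = 0. Then the matrix-valued functions W₁(t) := U·diag(√w₁(t), …, √w_d(t))·Q and W₂(t) := Qᵀ·diag(√w₁(t), …, √w_d(t))·Vᵀ satisfy W₁(0) = U·diag(e^{−δ₁}, …, e^{−δ_d})·Q, W₂(0) = Qᵀ·diag(e^{−δ₁}, …, e^{−δ_d})·Vᵀ, and the coupled matrix differential equations Ẇ₁(t) = (Σxy − Σx·W₁(t)·W₂(t))·W₂(t)ᵀ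 and Ẇ₂(t) = W₁(t)ᵀ·(Σxy − Σx·W₁(t)·W₂(t)) for all t ≥ 0. -/
open Matrix

theorem hasDerivAt_mul_diagonal_mul_apply {m n l : Type*} [Fintype n] [DecidableEq n]
    (A : Matrix m n ℝ) (B : Matrix n l ℝ) {f : n → ℝ → ℝ} {f' : n → ℝ} {t : ℝ}
    (hf : ∀ i, HasDerivAt (f i) (f' i) t) (a : m) (b : l) :
    HasDerivAt (fun s => (A * Matrix.diagonal (fun i => f i s) * B) a b)
      ((A * Matrix.diagonal f' * B) a b) t := by
  have hentry (g : n → ℝ) :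
      (A * Matrix.diagonal g * B) a b = ∑ i, A a i * g i * B i b := by
    rw [Matrix.mul_apply]
    simp only [Matrix.mul_diagonal]
  simp only [hentry]
  exact HasDerivAt.fun_sum fun i _ => ((hf i).const_mul (A a i)).mul_const (B i b)

theorem hasDerivAt_sqrt_of_logistic {w : ℝ → ℝ} {c k t : ℝ} (hpos : 0 < w t)
    (hw : HasDerivAt w (2 * w t * (c - k * w t)) t) :
    HasDerivAt (fun s => Real.sqrt (w s)) (Real.sqrt (w t) * (c - k * w t)) t := by
  refine (hw.sqrt hpos.ne').congr_deriv ?_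
  have h := Real.sqrt_pos.2 hpos
  have h2 := Real.sq_sqrt hpos.le
  rw [div_eq_iff (by positivity)]
  linear_combination -2 * (c - k * w t) * h2

theorem logistic_pos_and_hasDerivAt {c k x t : ℝ} (hc : 0 < c) (hk : 0 ≤ k) (ht : 0 ≤ t)
    {w : ℝ → ℝ}
    (hw : ∀ s, w s = c * Real.exp (2 * c * s - 2 * x) /
      (k * (Real.exp (2 * c * s - 2 * x) - Real.exp (-2 * x)) + c)) :
    0 < w t ∧ HasDerivAt w (2 * w t * (c - k * w t)) t := by
  have hexp : Real.exp (-2 * x) ≤ Real.exp (2 * c * t - 2 * x) :=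
    Real.exp_le_exp.2 (by nlinarith [mul_nonneg hc.le ht])
  have hden : 0 < k * (Real.exp (2 * c * t - 2 * x) - Real.exp (-2 * x)) + c :=
    add_pos_of_nonneg_of_pos (mul_nonneg hk (sub_nonneg.2 hexp)) hc
  refine ⟨by rw [hw]; positivity, ?_⟩
  have he : HasDerivAt (fun s => Real.exp (2 * c * s - 2 * x))
      (Real.exp (2 * c * t - 2 * x) * (2 * c)) t := by
    simpa using (((hasDerivAt_id t).const_mul (2 * c)).sub_const (2 * x)).exp
  rw [hw t, funext hw]
  refine ((he.const_mul c).fun_div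
    (((he.sub_const (Real.exp (-2 * x))).const_mul k).add_const c) hden.ne').congr_deriv ?_
  have := hden.ne'
  generalize Real.exp (2 * c * t - 2 * x) = E at *
  generalize Real.exp (-2 * x) = F at *
  field_simp

theorem hyperbolic_pos_and_hasDerivAt {e k t : ℝ} (he : 0 < e) (hk : 0 ≤ k) (ht : 0 ≤ t)
    {w : ℝ → ℝ} (hw : ∀ s, w s = e / (1 + 2 * e * k * s)) :
    0 < w t ∧ HasDerivAt w (2 * w t * (0 - k * w t)) t := by
  have hden : 0 < 1 + 2 * e * k * t := by positivity
  refine ⟨by rw [hw]; positivity, ?_⟩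
  have hd : HasDerivAt (fun s => 1 + 2 * e * k * s) (2 * e * k) t := by
    simpa using ((hasDerivAt_id t).const_mul (2 * e * k)).const_add 1
  rw [hw t, funext hw]
  refine ((hasDerivAt_const t e).fun_div hd hden.ne').congr_deriv ?_
  field_simp
  ring

/-- Theorem 1 (exactly commutative case ε = 0, square case with orthogonal mixing `Q`):
`W₁(t) = U·diag(√wᵢ(t))·Q` and `W₂(t) = Qᵀ·diag(√wᵢ(t))·Vᵀ`, with the explicit scalars
`wᵢ`, solve the coupled gradient-flow equations
`Ẇ₁ = (Σxy − ΣxW₁W₂)W₂ᵀ`, `Ẇ₂ = W₁ᵀ(Σxy − ΣxW₁W₂)` with initialization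
`W₁(0) = U·diag(e^{−δᵢ})·Q`, `W₂(0) = Qᵀ·diag(e^{−δᵢ})·Vᵀ`, where
`Σx = U·diag(λ)·Uᵀ` and `Σxy = U·diag(σ)·Vᵀ`. -/
theorem stmt_11 (d : ℕ) (U V Q : Matrix (Fin d) (Fin d) ℝ)
    (hU : Uᵀ * U = 1) (hV : Vᵀ * V = 1) (hQ : Qᵀ * Q = 1)
    (lam σ δ : Fin d → ℝ) (hlam : ∀ i, 0 ≤ lam i) (hσ : ∀ i, 0 ≤ σ i)
    (Sx : Matrix (Fin d) (Fin d) ℝ) (Sxy : Matrix (Fin d) (Fin d) ℝ)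
    (hSx : Sx = U * Matrix.diagonal lam * Uᵀ)
    (hSxy : Sxy = U * Matrix.diagonal σ * Vᵀ)
    (w : Fin d → ℝ → ℝ)
    (hwpos : ∀ i : Fin d, 0 < σ i → ∀ t : ℝ,
      w i t = σ i * Real.exp (2 * σ i * t - 2 * δ i) /
        (lam i * (Real.exp (2 * σ i * t - 2 * δ i) - Real.exp (-2 * δ i)) + σ i))
    (hwzero : ∀ i : Fin d, σ i = 0 → ∀ t : ℝ,
      w i t = Real.exp (-2 * δ i) / (1 + 2 * Real.exp (-2 * δ i) * lam i * t))
    (W₁ W₂ : ℝ → Matrix (Fin d) (Fin d) ℝ)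
    (hW₁ : ∀ t : ℝ, W₁ t = U * Matrix.diagonal (fun i => Real.sqrt (w i t)) * Q)
    (hW₂ : ∀ t : ℝ, W₂ t = Qᵀ * Matrix.diagonal (fun i => Real.sqrt (w i t)) * Vᵀ) :
    W₁ 0 = U * Matrix.diagonal (fun i => Real.exp (-δ i)) * Q ∧
    W₂ 0 = Qᵀ * Matrix.diagonal (fun i => Real.exp (-δ i)) * Vᵀ ∧
    ∀ t : ℝ, 0 ≤ t → ∀ a b : Fin d,
      HasDerivAt (fun s : ℝ => W₁ s a b)
        (((Sxy - Sx * (W₁ t * W₂ t)) * (W₂ t)ᵀ) a b) t ∧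
      HasDerivAt (fun s : ℝ => W₂ s a b)
        (((W₁ t)ᵀ * (Sxy - Sx * (W₁ t * W₂ t))) a b) t := by
  have hw : ∀ t, 0 ≤ t → ∀ i,
      0 < w i t ∧ HasDerivAt (w i) (2 * w i t * (σ i - lam i * w i t)) t := by
    intro t ht i
    rcases (hσ i).lt_or_eq with h | h
    · exact logistic_pos_and_hasDerivAt h (hlam i) ht (hwpos i h)
    · rw [← h]
      exact hyperbolic_pos_and_hasDerivAt (Real.exp_pos _) (hlam i) ht (hwzero i h.symm)
  have hinit : (fun i => Real.sqrt (w i 0)) = fun i => Real.exp (-δ i) := by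
    funext i
    have h0 : w i 0 = Real.exp (-δ i) ^ 2 := by
      rw [← Real.exp_nat_mul]
      rcases (hσ i).lt_or_eq with h | h
      · rw [hwpos i h]
        simp [h.ne']
      · rw [hwzero i h.symm]
        simp
    rw [h0, Real.sqrt_sq (Real.exp_pos _).le]
  refine ⟨by rw [hW₁, hinit], by rw [hW₂, hinit], fun t ht a b => ?_⟩
  have hQ' : Q * Qᵀ = 1 := mul_eq_one_comm.1 hQ
  have hsqrt := fun i => hasDerivAt_sqrt_of_logistic (hw t ht i).1 (hw t ht i).2
  have hprod : W₁ t * W₂ t = U * Matrix.diagonal (fun i => w i t) * Vᵀ := by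
    have hdiag : Matrix.diagonal (fun i => w i t) =
        Matrix.diagonal (fun i => Real.sqrt (w i t)) *
          Matrix.diagonal (fun i => Real.sqrt (w i t)) := by
      rw [Matrix.diagonal_mul_diagonal]
      congr 1
      funext i
      exact (Real.mul_self_sqrt (hw t ht i).1.le).symm
    rw [hW₁, hW₂, hdiag]
    simp only [Matrix.mul_assoc]
    rw [← Matrix.mul_assoc Q, hQ', Matrix.one_mul]
  have hres : Sxy - Sx * (W₁ t * W₂ t) =
      U * Matrix.diagonal (fun i => σ i - lam i * w i t) * Vᵀ := by
    rw [hprod, hSx, hSxy, ← Matrix.diagonal_sub, Matrix.mul_sub, Matrix.sub_mul,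
      ← Matrix.diagonal_mul_diagonal]
    simp only [Matrix.mul_assoc]
    rw [← Matrix.mul_assoc Uᵀ, hU, Matrix.one_mul]
  have hdiag : Matrix.diagonal (fun i => Real.sqrt (w i t) * (σ i - lam i * w i t)) =
      Matrix.diagonal (fun i => Real.sqrt (w i t)) *
        Matrix.diagonal (fun i => σ i - lam i * w i t) :=
    (Matrix.diagonal_mul_diagonal _ _).symm
  constructor
  · have hrhs : (Sxy - Sx * (W₁ t * W₂ t)) * (W₂ t)ᵀ =
        U * Matrix.diagonal (fun i => Real.sqrt (w i t) * (σ i - lam i * w i t)) * Q := by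
      rw [hres, hW₂, hdiag, (Matrix.commute_diagonal _ _).eq]
      simp only [Matrix.transpose_mul, Matrix.transpose_transpose, Matrix.diagonal_transpose,
        Matrix.mul_assoc]
      rw [← Matrix.mul_assoc Vᵀ, hV, Matrix.one_mul]
    rw [hrhs, funext hW₁]
    exact hasDerivAt_mul_diagonal_mul_apply U Q hsqrt a b
  · have hrhs : (W₁ t)ᵀ * (Sxy - Sx * (W₁ t * W₂ t)) =
        Qᵀ * Matrix.diagonal (fun i => Real.sqrt (w i t) * (σ i - lam i * w i t)) * Vᵀ := by
      rw [hres, hW₁, hdiag]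
      simp only [Matrix.transpose_mul, Matrix.diagonal_transpose, Matrix.mul_assoc]
      rw [← Matrix.mul_assoc Uᵀ, hU, Matrix.one_mul]
    rw [hrhs, funext hW₂]
    exact hasDerivAt_mul_diagonal_mul_apply Qᵀ Vᵀ hsqrt a b
end

section
/- Let U be an orthogonal d×d real matrix, D_x a diagonal d×d matrix, Σxy a d×d real matrix, ε > 0, and B a symmetric d×d matrix with ‖B‖ ≤ ε. Set Σx := U·(D_x + B)·Uᵀ and Σx⁰ := U·D_x·Uᵀ. Let (W₁, W₂) and (W₁⁰, W₂⁰) be continuously differentiable d×d matrix-valued functions on [0, ∞) with the same initial conditions W₁(0) = W₁⁰(0), W₂(0) = W₂⁰(0), satisfying respectively Ẇ₁ = (Σxy − Σx·W₁W₂)·W₂ᵀ, Ẇ₂ = W₁ᵀ·(Σxy − Σx·W₁W₂), and Ẇ₁⁰ = (Σxy − Σx⁰·W₁⁰W₂⁰)·(W₂⁰)ᵀ, Ẇ₂⁰ = (W₁⁰)ᵀ·(Σxy − Σx⁰·W₁⁰W₂⁰). Assume there exists K > 0 such that ‖Wℓ(t)‖ ≤ K·√(1 + t) and ‖Wℓ⁰(t)‖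 ≤ K·√(1 + t) for ℓ ∈ {1, 2} and all t ≥ 0. Then there exist constants C > 0 and c > 0, depending only on K, d, ‖D_x‖ and ‖Σxy‖ (not on ε or B), such that ‖W₁(t) − W₁⁰(t)‖ + ‖W₂(t) − W₂⁰(t)‖ ≤ C·ε·e^{c·t²} for all t ≥ 0. -/
open Matrix

/-- The Frobenius norm of a real matrix. -/
noncomputable def frobNorm {d e : ℕ} (M : Matrix (Fin d) (Fin e) ℝ) : ℝ :=
  Real.sqrt (∑ i, ∑ j, (M i j) ^ 2)

attribute [local instance] Matrix.frobeniusNormedAddCommGroup Matrix.frobeniusNormedSpace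

lemma frobNorm_eq_norm {d e : ℕ} (M : Matrix (Fin d) (Fin e) ℝ) : frobNorm M = ‖M‖ := by
  rw [frobNorm, Matrix.frobenius_norm_def, Real.sqrt_eq_rpow]
  simp

lemma Matrix.hasDerivAt_of_entries {d e : ℕ} {W : ℝ → Matrix (Fin d) (Fin e) ℝ}
    {V : Matrix (Fin d) (Fin e) ℝ} {t : ℝ}
    (h : ∀ a b, HasDerivAt (fun s => W s a b) (V a b) t) : HasDerivAt W V t := by
  have key : HasDerivAt (fun s => ∑ a, ∑ b, W s a b • Matrix.single a b (1 : ℝ))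
      (∑ a, ∑ b, V a b • Matrix.single a b (1 : ℝ)) t :=
    HasDerivAt.fun_sum fun a _ => HasDerivAt.fun_sum fun b _ => (h a b).smul_const _
  have hsum (M : Matrix (Fin d) (Fin e) ℝ) :
      ∑ a, ∑ b, M a b • Matrix.single a b (1 : ℝ) = M := by
    simpa [Matrix.smul_single] using (Matrix.matrix_eq_sum_single M).symm
  simpa only [hsum] using key

/-- Lipschitz-type estimate for the residual `S - A W₁ W₂` under a perturbation `P` of `A`. -/
lemma norm_residual_sub_le {d : ℕ} {S A P X Y X' Y' : Matrix (Fin d) (Fin d) ℝ} {r p e : ℝ}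
    (hX : ‖X‖ ≤ r) (hY : ‖Y‖ ≤ r) (hY' : ‖Y'‖ ≤ r) (hP : ‖P‖ ≤ p)
    (he₁ : ‖X - X'‖ ≤ e) (he₂ : ‖Y - Y'‖ ≤ e) :
    ‖(S - (A + P) * (X * Y)) - (S - A * (X' * Y'))‖ ≤ ‖A‖ * (2 * r * e) + p * r ^ 2 := by
  have hr : 0 ≤ r := (norm_nonneg _).trans hX
  have he : 0 ≤ e := (norm_nonneg _).trans he₁
  have hp : 0 ≤ p := (norm_nonneg _).trans hP
  have hid : (S - (A + P) * (X * Y)) - (S - A * (X' * Y')) =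
      -(A * (X * (Y - Y') + (X - X') * Y') + P * (X * Y)) := by noncomm_ring
  have h₁ : ‖X * (Y - Y') + (X - X') * Y'‖ ≤ 2 * r * e := calc
    _ ≤ ‖X‖ * ‖Y - Y'‖ + ‖X - X'‖ * ‖Y'‖ :=
      norm_add_le_of_le (Matrix.frobenius_norm_mul _ _) (Matrix.frobenius_norm_mul _ _)
    _ ≤ r * e + e * r := by gcongr
    _ = 2 * r * e := by ring
  have h₂ : ‖X * Y‖ ≤ r ^ 2 := calc
    _ ≤ ‖X‖ * ‖Y‖ := Matrix.frobenius_norm_mul _ _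
    _ ≤ r * r := by gcongr
    _ = r ^ 2 := by ring
  rw [hid, norm_neg]
  calc _ ≤ ‖A‖ * ‖X * (Y - Y') + (X - X') * Y'‖ + ‖P‖ * ‖X * Y‖ :=
        norm_add_le_of_le (Matrix.frobenius_norm_mul _ _) (Matrix.frobenius_norm_mul _ _)
    _ ≤ _ := by gcongr

lemma norm_residual_le {d : ℕ} {S A X Y : Matrix (Fin d) (Fin d) ℝ} {r : ℝ}
    (hX : ‖X‖ ≤ r) (hY : ‖Y‖ ≤ r) : ‖S - A * (X * Y)‖ ≤ ‖S‖ + ‖A‖ * r ^ 2 := by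
  have hr : 0 ≤ r := (norm_nonneg _).trans hX
  calc _ ≤ ‖S‖ + ‖A‖ * (‖X‖ * ‖Y‖) :=
        (norm_sub_le _ _).trans <| by
          gcongr
          exact (Matrix.frobenius_norm_mul _ _).trans (by
            gcongr
            exact Matrix.frobenius_norm_mul _ _)
    _ ≤ ‖S‖ + ‖A‖ * (r * r) := by gcongr
    _ = _ := by ring

lemma norm_mul_sub_mul_le {d : ℕ} {G G' Z Z' : Matrix (Fin d) (Fin d) ℝ} {g g' r e : ℝ}
    (hG : ‖G - G'‖ ≤ g) (hG' : ‖G'‖ ≤ g') (hZ : ‖Z‖ ≤ r) (he : ‖Z - Z'‖ ≤ e) :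
    ‖G * Z - G' * Z'‖ ≤ g * r + g' * e := by
  have hid : G * Z - G' * Z' = (G - G') * Z + G' * (Z - Z') := by noncomm_ring
  have hg : 0 ≤ g := (norm_nonneg _).trans hG
  have hg' : 0 ≤ g' := (norm_nonneg _).trans hG'
  rw [hid]
  calc _ ≤ ‖G - G'‖ * ‖Z‖ + ‖G'‖ * ‖Z - Z'‖ :=
        norm_add_le_of_le (Matrix.frobenius_norm_mul _ _) (Matrix.frobenius_norm_mul _ _)
    _ ≤ _ := by gcongr

/-- Grönwall's inequality from a zero initial value, with coefficients growing in time. -/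
lemma norm_le_of_norm_deriv_le_linear_growth {E : Type*} [NormedAddCommGroup E]
    [NormedSpace ℝ E] {f f' : ℝ → E} {a b : ℝ} (ha : 0 < a) (hb : 0 ≤ b) (h0 : f 0 = 0)
    (hf : ∀ t, 0 ≤ t → HasDerivAt f (f' t) t)
    (hbound : ∀ t, 0 ≤ t → ‖f' t‖ ≤ a * (1 + t) * ‖f t‖ + b * (1 + t) ^ 2)
    {t : ℝ} (ht : 0 ≤ t) :
    ‖f t‖ ≤ b / a * Real.exp (a + 1) * Real.exp ((2 * a + 1) * t ^ 2) := by
  have hG := norm_le_gronwallBound_of_norm_deriv_right_le (f := f) (f' := f') (δ := 0)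
    (K := a * (1 + t)) (ε := b * (1 + t) ^ 2) (a := 0) (b := t)
    (fun s hs => (hf s hs.1).continuousAt.continuousWithinAt)
    (fun s hs => (hf s hs.1).hasDerivWithinAt) (by simp [h0])
    (fun s hs => (hbound s hs.1).trans (by
      have h1 := hs.1
      have h2 := hs.2.le
      gcongr)) t ⟨ht, le_rfl⟩
  have hk : a * (1 + t) ≠ 0 := by positivity
  rw [gronwallBound_of_K_ne_0 hk] at hG
  simp only [zero_mul, zero_add, sub_zero] at hG
  have hq : b * (1 + t) ^ 2 / (a * (1 + t)) = b / a * (1 + t) := by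
    field_simp
  rw [hq] at hG
  calc ‖f t‖ ≤ b / a * (1 + t) * (Real.exp (a * (1 + t) * t) - 1) := hG
    _ ≤ b / a * Real.exp t * Real.exp (a * (1 + t) * t) := by
      have h₁ : 1 + t ≤ Real.exp t := by linarith [Real.add_one_le_exp t]
      have h₂ : b / a * (1 + t) ≤ b / a * Real.exp t := by gcongr
      exact mul_le_mul h₂ (by linarith)
        (by linarith [Real.one_le_exp (show 0 ≤ a * (1 + t) * t by positivity)]) (by positivity)
    _ = b / a * Real.exp (t + a * (1 + t) * t) := by rw [Real.exp_add]; ring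
    _ ≤ b / a * Real.exp ((a + 1) + (2 * a + 1) * t ^ 2) := by
      refine mul_le_mul_of_nonneg_left (Real.exp_le_exp.2 ?_) (by positivity)
      nlinarith [sq_nonneg (t - 1), sq_nonneg t, mul_nonneg ha.le (sq_nonneg (t - 1)),
        mul_nonneg ha.le (sq_nonneg t)]
    _ = _ := by rw [Real.exp_add]; ring

/-- Theorem 1 (perturbation part): comparing the two-layer gradient flow for the
approximately commuting covariance `Σx = U(D_x + B)Uᵀ` (with `B` symmetric, `‖B‖ ≤ ε`)
to the exactly commuting flow (`B = 0`), started from the same initial conditions and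
satisfying the growth bounds `‖Wℓ(t)‖, ‖Wℓ⁰(t)‖ ≤ K√(1+t)`, there are constants
`C, c > 0` independent of `ε`, `B` and the trajectories such that
`‖W₁(t) − W₁⁰(t)‖ + ‖W₂(t) − W₂⁰(t)‖ ≤ C·ε·e^{ct²}` for all `t ≥ 0`. -/
theorem stmt_12 (d : ℕ) (U Dx Sxy : Matrix (Fin d) (Fin d) ℝ)
    (hU : Uᵀ * U = 1) (hDx : Dx.IsDiag) (K : ℝ) (hK : 0 < K) :
    ∃ C > (0 : ℝ), ∃ c > (0 : ℝ),
      ∀ ε > (0 : ℝ), ∀ B : Matrix (Fin d) (Fin d) ℝ, Bᵀ = B → frobNorm B ≤ ε →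
      ∀ W₁ W₂ W₁' W₂' : ℝ → Matrix (Fin d) (Fin d) ℝ,
      W₁ 0 = W₁' 0 → W₂ 0 = W₂' 0 →
      (∀ t : ℝ, 0 ≤ t → ∀ a b : Fin d,
        HasDerivAt (fun s : ℝ => W₁ s a b)
          (((Sxy - (U * (Dx + B) * Uᵀ) * (W₁ t * W₂ t)) * (W₂ t)ᵀ) a b) t) →
      (∀ t : ℝ, 0 ≤ t → ∀ a b : Fin d,
        HasDerivAt (fun s : ℝ => W₂ s a b)
          (((W₁ t)ᵀ * (Sxy - (U * (Dx + B) * Uᵀ) * (W₁ t * W₂ t))) a b) t) →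
      (∀ t : ℝ, 0 ≤ t → ∀ a b : Fin d,
        HasDerivAt (fun s : ℝ => W₁' s a b)
          (((Sxy - (U * Dx * Uᵀ) * (W₁' t * W₂' t)) * (W₂' t)ᵀ) a b) t) →
      (∀ t : ℝ, 0 ≤ t → ∀ a b : Fin d,
        HasDerivAt (fun s : ℝ => W₂' s a b)
          (((W₁' t)ᵀ * (Sxy - (U * Dx * Uᵀ) * (W₁' t * W₂' t))) a b) t) →
      (∀ t : ℝ, 0 ≤ t → frobNorm (W₁ t) ≤ K * Real.sqrt ( 1 + t)) →
      (∀ t : ℝ, 0 ≤ t → frobNorm (W₂ t) ≤ K * Real.sqrt (1 + t)) →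
      (∀ t : ℝ, 0 ≤ t → frobNorm (W₁' t) ≤ K * Real.sqrt (1 + t)) →
      (∀ t : ℝ, 0 ≤ t → frobNorm (W₂' t) ≤ K * Real.sqrt (1 + t)) →
      ∀ t : ℝ, 0 ≤ t →
        frobNorm (W₁ t - W₁' t) + frobNorm (W₂ t - W₂' t)
          ≤ C * ε * Real.exp (c * t ^ 2) := by
  have htr (M : Matrix (Fin d) (Fin d) ℝ) : ‖Mᵀ‖ = ‖M‖ := Matrix.frobenius_norm_transpose M
  simp only [frobNorm_eq_norm]
  set A := U * Dx * Uᵀ with hA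
  set a : ℝ := ‖Sxy‖ + 3 * ‖A‖ * K ^ 2 + 1 with ha_def
  have ha : 0 < a := by positivity
  set q : ℝ := (‖U‖ ^ 2 + 1) * K ^ 3 with hq_def
  have hq : 0 < q := by positivity
  refine ⟨2 * (q / a * Real.exp (a + 1)), by positivity, 2 * a + 1, by positivity, ?_⟩
  intro ε hε B _ hB X Y X' Y' hX0 hY0 hdX hdY hdX' hdY' hX hY hX' hY' t ht
  set P := U * B * Uᵀ with hP_def
  have hAP : U * (Dx + B) * Uᵀ = A + P := by simp only [hA, hP_def]; noncomm_ring
  rw [hAP] at hdX hdY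
  have hP : ‖P‖ ≤ (‖U‖ ^ 2 + 1) * ε := calc
    ‖P‖ ≤ ‖U‖ * ‖B‖ * ‖U‖ := by
      refine (Matrix.frobenius_norm_mul _ _).trans ?_
      rw [htr]
      gcongr
      exact Matrix.frobenius_norm_mul _ _
    _ ≤ ‖U‖ * ε * ‖U‖ := by gcongr
    _ ≤ _ := by nlinarith
  have key := norm_le_of_norm_deriv_le_linear_growth
    (f := fun s => (X s - X' s, Y s - Y' s)) (a := a) (b := q * ε) ha (by positivity)
    (by simp [hX0, hY0])
    (fun s hs =>
      ((Matrix.hasDerivAt_of_entries (hdX s hs)).sub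
        (Matrix.hasDerivAt_of_entries (hdX' s hs))).prodMk
      ((Matrix.hasDerivAt_of_entries (hdY s hs)).sub
        (Matrix.hasDerivAt_of_entries (hdY' s hs)))) ?_ ht
  · have h₁ := (norm_fst_le _).trans key
    have h₂ := (norm_snd_le _).trans key
    calc _ ≤ _ := add_le_add h₁ h₂
      _ = _ := by ring
  · intro s hs
    set e := ‖(X s - X' s, Y s - Y' s)‖ with he_def
    have he₁ : ‖X s - X' s‖ ≤ e := norm_fst_le (X s - X' s, Y s - Y' s)
    have he₂ : ‖Y s - Y' s‖ ≤ e := norm_snd_le (X s - X' s, Y s - Y' s)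
    have he : 0 ≤ e := norm_nonneg _
    set r := K * Real.sqrt (1 + s) with hr_def
    have hr : 0 ≤ r := by positivity
    have hr2 : r ^ 2 = K ^ 2 * (1 + s) := by
      rw [hr_def, mul_pow, Real.sq_sqrt (by linarith)]
    have hr3 : r ^ 3 ≤ K ^ 3 * (1 + s) ^ 2 := by
      have h1 : Real.sqrt (1 + s) ≤ 1 + s :=
        Real.sqrt_le_iff.2 ⟨by linarith, by nlinarith⟩
      calc r ^ 3 = K ^ 3 * (1 + s) * Real.sqrt (1 + s) := by
            rw [pow_succ, hr2, hr_def]; ring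
        _ ≤ K ^ 3 * (1 + s) * (1 + s) := by gcongr
        _ = _ := by ring
    have hG := norm_residual_sub_le (S := Sxy) (A := A) (hX s hs) (hY s hs) (hY' s hs) hP he₁ he₂
    have hG' := norm_residual_le (S := Sxy) (A := A) (hX' s hs) (hY' s hs)
    have hfin : (‖A‖ * (2 * r * e) + (‖U‖ ^ 2 + 1) * ε * r ^ 2) * r +
        (‖Sxy‖ + ‖A‖ * r ^ 2) * e ≤ a * (1 + s) * e + q * ε * (1 + s) ^ 2 := calc
      _ = (‖Sxy‖ + 3 * ‖A‖ * r ^ 2) * e + (‖U‖ ^ 2 + 1) * ε * r ^ 3 := by ring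
      _ ≤ (‖Sxy‖ * (1 + s) + 3 * ‖A‖ * r ^ 2 + (1 + s)) * e +
          (‖U‖ ^ 2 + 1) * ε * (K ^ 3 * (1 + s) ^ 2) := by
        have h1 : 0 ≤ ‖Sxy‖ * s := by positivity
        refine add_le_add (mul_le_mul_of_nonneg_right ?_ he) (by gcongr)
        linarith
      _ = _ := by rw [hr2, ha_def, hq_def]; ring
    refine max_le ((norm_mul_sub_mul_le hG hG' ?_ ?_).trans hfin) ?_
    · rw [htr]; exact hY s hs
    · rw [← Matrix.transpose_sub, htr]; exact he₂
    · dsimp only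
      rw [← htr, Matrix.transpose_sub, Matrix.transpose_mul, Matrix.transpose_mul,
        Matrix.transpose_transpose, Matrix.transpose_transpose]
      refine (norm_mul_sub_mul_le ?_ ?_ (hX s hs) he₁).trans hfin
      · rw [← Matrix.transpose_sub, htr]; exact hG
      · rw [htr]; exact hG'
end

section
/- Let σ > 0, λ > 0 and η > 0 with 2·η·σ < 1, and let (a_t) be a real sequence satisfying a_{t+1} = a_t + η·a_t·(σ − λ·a_t)·(2 + η·(σ − λ·a_t)) with 0 < a₀ < σ/λ. Then the sequence (a_t) is strictly increasing and satisfies 0 < a_t < σ/λ for all t ∈ ℕ. -/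
/-- The discrete scalar product recurrence
`a_{t+1} = a_t + η·a_t·(σ − λa_t)·(2 + η(σ − λa_t))` with `0 < a₀ < σ/λ` and
`2ησ < 1` is strictly increasing and stays in `(0, σ/λ)`. -/
theorem stmt_14 (σ lam η : ℝ) (hσ : 0 < σ) (hlam : 0 < lam) (hη : 0 < η)
    (hstep : 2 * η * σ < 1) (a : ℕ → ℝ)
    (hrec : ∀ t : ℕ, a (t + 1)
      = a t + η * a t * (σ - lam * a t) * (2 + η * (σ - lam * a t)))
    (h0 : 0 < a 0) (h0' : a 0 < σ / lam) :
    StrictMono a ∧ ∀ t : ℕ, 0 < a t ∧ a t < σ / lam := by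
  have increment_pos : ∀ t, 0 < a t → a t < σ / lam → a t < a (t + 1) := by
    intro t hpos hlt
    rw [lt_div_iff₀ hlam] at hlt
    have hd : 0 < σ - lam * a t := by linarith
    rw [hrec t]
    exact lt_add_of_pos_right _ (by positivity)
  have bounds : ∀ t, 0 < a t ∧ a t < σ / lam := by
    intro t
    induction t with
    | zero => exact ⟨h0, h0'⟩
    | succ t ih =>
      obtain ⟨hpos, hlt⟩ := ih
      refine ⟨hpos.trans (increment_pos t hpos hlt), ?_⟩
      rw [lt_div_iff₀ hlam] at hlt ⊢
      have hd : 0 < σ - lam * a t := by linarith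
      have hx : 0 < η * (σ - lam * a t) := by positivity
      have hy : 0 < 2 - η * (lam * a t) := by linarith
      have hfactor : 0 < 1 - η * (lam * a t) * (2 + η * (σ - lam * a t)) := by
        linarith [mul_pos hx hy]
      rw [hrec t]
      linarith [mul_pos hd hfactor]
  exact ⟨strictMono_nat_of_lt_succ fun t => increment_pos t (bounds t).1 (bounds t).2, bounds⟩
end

section
/- Let λ > 0 and η > 0, and let (a_t) be a real sequence satisfying a_{t+1} = a_t·(1 − η·λ·a_t)² with a₀ > 0 and η·λ·a₀ ≤ 1. Then a_t ≤ a₀ / (1 + a₀·λ·η·t) for all t ∈ ℕ. -/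
theorem one_sub_sq_mul_one_add_le_one {y : ℝ} (h0 : 0 ≤ y) (h1 : y ≤ 1) :
    (1 - y) ^ 2 * (1 + y) ≤ 1 := by
  nlinarith [mul_nonneg h0 (sub_nonneg.2 h1), mul_nonneg (mul_nonneg h0 h0) (sub_nonneg.2 h1)]

/-- Theorem 3, case σ = 0: the recurrence `a_{t+1} = a_t(1 − ηλa_t)²` with
`a₀ > 0` and `ηλa₀ ≤ 1` satisfies `a_t ≤ a₀/(1 + a₀ληt)`. -/
theorem stmt_16 (lam η : ℝ) (hlam : 0 < lam) (hη : 0 < η) (a : ℕ → ℝ)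
    (hrec : ∀ t : ℕ, a (t + 1) = a t * (1 - η * lam * a t) ^ 2)
    (h0 : 0 < a 0) (h0' : η * lam * a 0 ≤ 1) :
    ∀ t : ℕ, a t ≤ a 0 / (1 + a 0 * lam * η * t) := by
  have hc : 0 < η * lam := mul_pos hη hlam
  have key : ∀ t : ℕ, 0 ≤ a t ∧ η * lam * a t ≤ 1 ∧
      a t * (1 + a 0 * lam * η * t) ≤ a 0 := by
    intro t
    induction t with
    | zero => exact ⟨h0.le, h0', by simp⟩
    | succ t ih =>
      obtain ⟨hpos, hle, hbound⟩ := ih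
      have hy : 0 ≤ η * lam * a t := mul_nonneg hc.le hpos
      have hsq : (1 - η * lam * a t) ^ 2 ≤ 1 := pow_le_one₀ (by linarith) (by linarith)
      rw [hrec t]
      refine ⟨by positivity, ?_, ?_⟩
      · rw [← mul_assoc]
        exact mul_le_one₀ hle (sq_nonneg _) hsq
      · calc a t * (1 - η * lam * a t) ^ 2 * (1 + a 0 * lam * η * (t + 1 : ℕ))
            = (1 - η * lam * a t) ^ 2 *
                (a t * (1 + a 0 * lam * η * t) + a 0 * (η * lam * a t)) := by
              push_cast; ring
          _ ≤ (1 - η * lam * a t) ^ 2 * (a 0 + a 0 * (η * lam * a t)) := by gcongr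
          _ = a 0 * ((1 - η * lam * a t) ^ 2 * (1 + η * lam * a t)) := by ring
          _ ≤ a 0 := mul_le_of_le_one_right h0.le (one_sub_sq_mul_one_add_le_one hy hle)
  intro t
  rw [le_div_iff₀ (by positivity)]
  exact (key t).2.2
end

section
/- Let r ≥ 1, σ₁ > σ₂ > … > σ_r > 0, λ₁, …, λ_r > 0, and let η > 0 satisfy η < 1/(2σ₁) and, for all 1 ≤ i ≤ r − 1, η < 2(σᵢ − σᵢ₊₁)/σᵢ² and η < (σᵢ − σᵢ₊₁)/(2σᵢ₊₁²). For each δ > 0 and 1 ≤ i ≤ r, let (a_i^{δ,(t)})_{t∈ℕ} be the sequence with a_i^{δ,(0)} = e^{−2δ} and a_i^{δ,(t+1)} = a_i^{δ,(t)} + η·a_i^{δ,(t)}·(σᵢ − λᵢ·a_i^{δ,(t)})·(2 + η·(σᵢ − λᵢ·a_i^{δ,(t)})), and set N_j(δ) := ⌊δ/(η·σ_j)⌋ for 1 ≤ j ≤ r and N₀(δ) := 0. Then, as δ → ∞: (1) for all 0 ≤ j < i ≤ r, a_i^{δ,(N_j(δ))} → 0; and (2) for all 1 ≤ i < j ≤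 r, a_i^{δ,(N_j(δ))} → σᵢ/λᵢ. -/
open Filter

/-- The iterates of the normalized map `x ↦ x (1 + s (1 - x))²` stay in `(0, 1)`. -/
theorem normalized_iterate_mem_Ioo {s : ℝ} (hs : 0 < s) (hs2 : s < 1 / 2) {x : ℕ → ℝ}
    (h0 : 0 < x 0) (h1 : x 0 < 1)
    (hx : ∀ t, x (t + 1) = x t * (1 + s * (1 - x t)) ^ 2) (t : ℕ) :
    0 < x t ∧ x t < 1 := by
  induction t with
  | zero => exact ⟨h0, h1⟩
  | succ t ih =>
    obtain ⟨hp, hl⟩ := ih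
    have hd : 0 < 1 - x t := by linarith
    rw [hx]
    refine ⟨by positivity, ?_⟩
    have hfac : 1 - x t * (1 + s * (1 - x t)) ^ 2
        = (1 - x t) * (1 - s * (2 * x t + s * (x t * (1 - x t)))) := by ring
    have hin : 2 * x t + s * (x t * (1 - x t)) < 2 := by
      have : s * (x t * (1 - x t)) ≤ 1 * (1 * (1 - x t)) := by gcongr; linarith
      linarith
    have hq : 0 < 1 - s * (2 * x t + s * (x t * (1 - x t))) := by nlinarith
    have := mul_pos hd hq
    linarith

theorem normalized_iterate_le_exp {s : ℝ} (hs : 0 < s) (hs2 : s < 1 / 2) {x : ℕ → ℝ}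
    (h0 : 0 < x 0) (h1 : x 0 < 1)
    (hx : ∀ t, x (t + 1) = x t * (1 + s * (1 - x t)) ^ 2) (t : ℕ) :
    x t ≤ x 0 * Real.exp (2 * s * t) := by
  induction t with
  | zero => simp
  | succ t ih =>
    obtain ⟨hp, hl⟩ := normalized_iterate_mem_Ioo hs hs2 h0 h1 hx t
    have hd : 0 < 1 - x t := by linarith
    have hg : 1 + s * (1 - x t) ≤ Real.exp s := by
      have := Real.add_one_le_exp s
      nlinarith
    calc x (t + 1) = x t * (1 + s * (1 - x t)) ^ 2 := hx t
      _ ≤ (x 0 * Real.exp (2 * s * t)) * Real.exp s ^ 2 := by gcongr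
      _ = x 0 * Real.exp (2 * s * (t + 1 : ℕ)) := by
        rw [mul_assoc, ← Real.exp_nat_mul, ← Real.exp_add]
        push_cast
        ring_nf

/-- Up to the time it passes the level `c`, the normalized iterate grows at least at the
exponential rate attained at `c`. -/
theorem normalized_iterate_growth {s c : ℝ} (hs : 0 < s) (hs2 : s < 1 / 2) (hc1 : c < 1)
    {x : ℕ → ℝ} (h0 : 0 < x 0) (h1 : x 0 < 1)
    (hx : ∀ t, x (t + 1) = x t * (1 + s * (1 - x t)) ^ 2) (t : ℕ) :
    c ≤ x t ∨ x 0 * Real.exp (2 * Real.log (1 + s * (1 - c)) * t) ≤ x t := by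
  induction t with
  | zero => simp
  | succ t ih =>
    obtain ⟨hp, hl⟩ := normalized_iterate_mem_Ioo hs hs2 h0 h1 hx t
    have hc : 0 < s * (1 - c) := mul_pos hs (by linarith)
    rcases le_or_gt c (x t) with h | h
    · left
      rw [hx]
      have : 0 ≤ s * (1 - x t) := mul_nonneg hs.le (by linarith)
      have : 1 ≤ (1 + s * (1 - x t)) ^ 2 := one_le_pow₀ (by linarith)
      nlinarith
    · right
      have ih := ih.resolve_left (not_le.mpr h)
      calc x 0 * Real.exp (2 * Real.log (1 + s * (1 - c)) * (t + 1 : ℕ))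
          = (x 0 * Real.exp (2 * Real.log (1 + s * (1 - c)) * t))
              * Real.exp (Real.log (1 + s * (1 - c))) ^ 2 := by
            rw [mul_assoc (x 0), ← Real.exp_nat_mul, ← Real.exp_add]
            push_cast
            ring_nf
        _ = (x 0 * Real.exp (2 * Real.log (1 + s * (1 - c)) * t)) * (1 + s * (1 - c)) ^ 2 := by
            rw [Real.exp_log (by linarith)]
        _ ≤ x t * (1 + s * (1 - x t)) ^ 2 := by gcongr
        _ = x (t + 1) := (hx t).symm

/-- Once above the level `c`, the normalized iterate converges to `1` geometrically. -/
theorem normalized_iterate_contraction {s c : ℝ} (hs : 0 < s) (hs2 : s < 1 / 2)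
    (hc0 : 0 < c) (hc1 : c < 1) {x : ℕ → ℝ} (h0 : 0 < x 0) (h1 : x 0 < 1)
    (hx : ∀ t, x (t + 1) = x t * (1 + s * (1 - x t)) ^ 2) {t : ℕ} (ht : c ≤ x t) (k : ℕ) :
    c ≤ x (t + k) ∧ 1 - x (t + k) ≤ (1 - 2 * s * c) ^ k := by
  induction k with
  | zero => exact ⟨ht, by simp; linarith⟩
  | succ k ih =>
    obtain ⟨hp, hl⟩ := normalized_iterate_mem_Ioo hs hs2 h0 h1 hx (t + k)
    obtain ⟨hc, hk⟩ := ih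
    rw [← add_assoc, hx]
    set y := x (t + k)
    have hd : 0 < 1 - y := by linarith
    have hsc : 0 ≤ 1 - 2 * s * c := by nlinarith
    constructor
    · have : 0 ≤ s * (1 - y) := by positivity
      have : 1 ≤ (1 + s * (1 - y)) ^ 2 := one_le_pow₀ (by linarith)
      nlinarith
    · have hfac : 1 - y * (1 + s * (1 - y)) ^ 2
          = (1 - y) * (1 - 2 * s * y - s ^ 2 * (y * (1 - y))) := by ring
      rw [hfac, pow_succ]
      have hq : 1 - 2 * s * y - s ^ 2 * (y * (1 - y)) ≤ 1 - 2 * s * c := by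
        have : 0 ≤ s ^ 2 * (y * (1 - y)) := by positivity
        have : s * c ≤ s * y := by gcongr
        linarith
      calc (1 - y) * (1 - 2 * s * y - s ^ 2 * (y * (1 - y)))
          ≤ (1 - y) * (1 - 2 * s * c) := by gcongr
        _ ≤ (1 - 2 * s * c) ^ k * (1 - 2 * s * c) := by gcongr

theorem tendsto_const_mul_exp_neg_mul (K : ℝ) {b : ℝ} (hb : 0 < b) :
    Tendsto (fun δ : ℝ => K * Real.exp (-b * δ)) atTop (nhds 0) := by
  have h : Tendsto (fun δ : ℝ => -b * δ) atTop atBot :=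
    tendsto_id.const_mul_atTop_of_neg (by linarith)
  simpa using (Real.tendsto_exp_atBot.comp h).const_mul K

theorem tendsto_normalized_iterate_zero {s q K : ℝ} (hs : 0 < s) (hs2 : s < 1 / 2)
    (hK : 0 < K) (hq : s < q) {x : ℝ → ℕ → ℝ} (h0 : ∀ δ, x δ 0 = K * Real.exp (-2 * δ))
    (hx : ∀ δ t, x δ (t + 1) = x δ t * (1 + s * (1 - x δ t)) ^ 2) :
    Tendsto (fun δ => x δ ⌊δ / q⌋₊) atTop (nhds 0) := by
  have hq0 : 0 < q := hs.trans hq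
  have hb : 0 < 2 * (1 - s / q) := by
    have := (div_lt_one hq0).mpr hq
    linarith
  have hsmall := (tendsto_const_mul_exp_neg_mul K two_pos).eventually_lt_const one_pos
  refine tendsto_of_tendsto_of_tendsto_of_le_of_le' tendsto_const_nhds
    (tendsto_const_mul_exp_neg_mul K hb) ?_ ?_
  · filter_upwards [hsmall] with δ hδ
    exact (normalized_iterate_mem_Ioo hs hs2 (by rw [h0]; positivity) (by rwa [h0])
      (hx δ) _).1.le
  · filter_upwards [hsmall, eventually_ge_atTop 0] with δ hδ hδ0
    have hfl : (⌊δ / q⌋₊ : ℝ) ≤ δ / q := Nat.floor_le (by positivity)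
    calc x δ ⌊δ / q⌋₊ ≤ x δ 0 * Real.exp (2 * s * ⌊δ / q⌋₊) :=
          normalized_iterate_le_exp hs hs2 (by rw [h0]; positivity) (by rwa [h0]) (hx δ) _
      _ ≤ x δ 0 * Real.exp (2 * s * (δ / q)) := by
          rw [h0]
          gcongr
      _ = K * Real.exp (-(2 * (1 - s / q)) * δ) := by
          rw [h0, mul_assoc, ← Real.exp_add]
          ring_nf

theorem tendsto_normalized_iterate_one {s q K : ℝ} (hs : 0 < s) (hs2 : s < 1 / 2)
    (hK : 0 < K) (hq0 : 0 < q) (hq : q < Real.log (1 + s)) {x : ℝ → ℕ → ℝ}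
    (h0 : ∀ δ, x δ 0 = K * Real.exp (-2 * δ))
    (hx : ∀ δ t, x δ (t + 1) = x δ t * (1 + s * (1 - x δ t)) ^ 2) :
    Tendsto (fun δ => x δ ⌊δ / q⌋₊) atTop (nhds 1) := by
  obtain ⟨c, hcL, hc0, hc1⟩ :
      ∃ c : ℝ, q < Real.log (1 + s * (1 - c)) ∧ 0 < c ∧ c < 1 := by
    have hcont : ContinuousAt (fun c : ℝ => Real.log (1 + s * (1 - c))) 0 := by
      refine ContinuousAt.log (by fun_prop) ?_
      simp only [sub_zero, mul_one]
      positivity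
    have hev : ∀ᶠ c in nhds (0 : ℝ), q < Real.log (1 + s * (1 - c)) :=
      hcont.eventually_const_lt (by simpa using hq)
    have hev' := (hev.filter_mono (nhdsWithin_le_nhds (s := Set.Ioi 0))).and
      (Ioo_mem_nhdsGT (zero_lt_one' ℝ))
    exact hev'.exists
  set L := Real.log (1 + s * (1 - c))
  have hL : 0 < L := hq0.trans hcL
  have hsmall := (tendsto_const_mul_exp_neg_mul K two_pos).eventually_lt_const one_pos
  have hrate : 0 < 2 * (L / q - 1) := by
    have := (one_lt_div hq0).mpr hcL
    linarith
  rw [Metric.tendsto_atTop']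
  intro ε hε
  obtain ⟨k, hk⟩ := exists_pow_lt_of_lt_one hε
    (show 1 - 2 * s * c < 1 by have := mul_pos hs hc0; linarith)
  have hbig : ∀ᶠ δ : ℝ in atTop,
      1 < K * Real.exp (2 * (L / q - 1) * δ - 2 * L * (k + 1)) := by
    have h1 : Tendsto (fun δ : ℝ => 2 * (L / q - 1) * δ - 2 * L * (k + 1)) atTop atTop :=
      tendsto_atTop_add_const_right _ _ (tendsto_id.const_mul_atTop hrate)
    exact ((Real.tendsto_exp_atTop.comp h1).const_mul_atTop hK).eventually_gt_atTop 1
  have hlong : ∀ᶠ δ : ℝ in atTop, (k : ℝ) ≤ δ / q :=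
    (tendsto_id.atTop_div_const hq0).eventually_ge_atTop _
  have key : ∀ᶠ δ : ℝ in atTop, dist (x δ ⌊δ / q⌋₊) 1 < ε := by
    filter_upwards [hsmall, hbig, hlong] with δ hδ hδb hδk
    have hx0 : 0 < x δ 0 := by rw [h0]; positivity
    have hx1 : x δ 0 < 1 := by rwa [h0]
    obtain ⟨m, hm⟩ := Nat.exists_eq_add_of_le' (Nat.le_floor hδk)
    have hmlow : δ / q - (k + 1) ≤ m := by
      have h := Nat.lt_floor_add_one (δ / q)
      rw [hm] at h
      push_cast at h
      linarith
    have hcm : c ≤ x δ m := by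
      refine (normalized_iterate_growth hs hs2 hc1 hx0 hx1 (hx δ) m).resolve_right ?_
      have hlt := (normalized_iterate_mem_Ioo hs hs2 hx0 hx1 (hx δ) m).2
      refine not_le.mpr (hlt.trans (hδb.trans_le ?_))
      rw [h0, mul_assoc K, ← Real.exp_add]
      gcongr
      calc 2 * (L / q - 1) * δ - 2 * L * (k + 1)
          = -2 * δ + 2 * L * (δ / q - (k + 1)) := by ring
        _ ≤ -2 * δ + 2 * L * m := by gcongr
    have hfin := (normalized_iterate_contraction hs hs2 hc0 hc1 hx0 hx1 (hx δ) hcm k).2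
    have hlt := (normalized_iterate_mem_Ioo hs hs2 hx0 hx1 (hx δ) (m + k)).2
    rw [hm, dist_comm, Real.dist_eq, abs_of_pos (by linarith)]
    exact hfin.trans_lt hk
  obtain ⟨M, hM⟩ := eventually_atTop.mp key
  exact ⟨M, fun δ hδ => hM δ hδ.le⟩

theorem sub_sq_div_two_le_log_one_add {s : ℝ} (hs : 0 ≤ s) :
    s - s ^ 2 / 2 ≤ Real.log (1 + s) := by
  refine le_trans ?_ (Real.le_log_one_add_of_nonneg hs)
  rw [le_div_iff₀ (by linarith)]
  nlinarith [pow_nonneg hs 3]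

/-- Corollary 3 (sequential learning for the discrete dynamics): under the step-size
conditions involving the relative eigen-gaps, with vanishing initialization `e^{−2δ}`
and rescaled phase-transition times `N_j(δ) = ⌊δ/(ησ_j)⌋` (and `N₀(δ) = 0`), as
`δ → ∞` the discrete iterate `a_i^{δ,(N_j(δ))}` tends to `0` when `j < i` and to
`σᵢ/λᵢ` when `j > i`. (Indices `i j : Fin r` are 0-based.) -/
theorem stmt_17 (r : ℕ) (hr : 1 ≤ r) (σ lam : Fin r → ℝ)
    (hσpos : ∀ i, 0 < σ i)
    (hσdec : ∀ i j : Fin r, i < j → σ j < σ i)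
    (hlam : ∀ i, 0 < lam i)
    (η : ℝ) (hη : 0 < η)
    (hη1 : η < 1 / (2 * σ ⟨0, by omega⟩))
    (hη2 : ∀ i j : Fin r, (j : ℕ) = (i : ℕ) + 1 → η < 2 * (σ i - σ j) / (σ i) ^ 2)
    (hη3 : ∀ i j : Fin r, (j : ℕ) = (i : ℕ) + 1 → η < (σ i - σ j) / (2 * (σ j) ^ 2))
    (a : ℝ → Fin r → ℕ → ℝ)
    (ha0 : ∀ (δ : ℝ) (i : Fin r), a δ i 0 = Real.exp (-2 * δ))
    (harec : ∀ (δ : ℝ) (i : Fin r) (t : ℕ), a δ i (t + 1)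
      = a δ i t + η * a δ i t * (σ i - lam i * a δ i t)
          * (2 + η * (σ i - lam i * a δ i t))) :
    (∀ i : Fin r, Tendsto (fun δ : ℝ => a δ i 0) atTop (nhds 0)) ∧
    (∀ i j : Fin r, j < i →
      Tendsto (fun δ : ℝ => a δ i ⌊δ / (η * σ j)⌋₊) atTop (nhds 0)) ∧
    (∀ i j : Fin r, i < j →
      Tendsto (fun δ : ℝ => a δ i ⌊δ / (η * σ j)⌋₊) atTop (nhds (σ i / lam i))) := by
  have hs : ∀ i, 0 < η * σ i := fun i => mul_pos hη (hσpos i)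
  have hs2 : ∀ i, η * σ i < 1 / 2 := by
    intro i
    have h0 := hσpos ⟨0, by omega⟩
    have hle : σ i ≤ σ ⟨0, by omega⟩ := by
      rcases (Fin.mk_le_of_le_val (Nat.zero_le i) : (⟨0, by omega⟩ : Fin r) ≤ i).eq_or_lt
        with h | h
      · rw [← h]
      · exact (hσdec _ _ h).le
    rw [lt_div_iff₀ (by positivity)] at hη1
    have := mul_le_mul_of_nonneg_left hle hη.le
    linarith
  have hK : ∀ i, 0 < lam i / σ i := fun i => div_pos (hlam i) (hσpos i)
  have hx0 : ∀ i δ, lam i / σ i * a δ i 0 = lam i / σ i * Real.exp (-2 * δ) :=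
    fun i δ => by rw [ha0]
  have hxrec : ∀ i δ t, lam i / σ i * a δ i (t + 1)
      = lam i / σ i * a δ i t * (1 + η * σ i * (1 - lam i / σ i * a δ i t)) ^ 2 := by
    intro i δ t
    have := (hσpos i).ne'
    rw [harec]
    field_simp
    ring
  have hscale : ∀ i δ t, a δ i t = σ i / lam i * (lam i / σ i * a δ i t) := by
    intro i δ t
    have := (hσpos i).ne'
    have := (hlam i).ne'
    field_simp
  refine ⟨fun i => ?_, fun i j hij => ?_, fun i j hij => ?_⟩
  · simpa [ha0] using tendsto_const_mul_exp_neg_mul 1 two_pos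
  · have h := tendsto_normalized_iterate_zero (q := η * σ j)
      (x := fun δ t => lam i / σ i * a δ i t) (hs i) (hs2 i) (hK i)
      (mul_lt_mul_of_pos_left (hσdec _ _ hij) hη) (hx0 i) (hxrec i)
    have h' := h.const_mul (σ i / lam i)
    rw [mul_zero] at h'
    exact h'.congr fun δ => (hscale i δ _).symm
  · have hgap : η * σ j < Real.log (1 + η * σ i) := by
      refine lt_of_lt_of_le ?_ (sub_sq_div_two_le_log_one_add (hs i).le)
      obtain ⟨n, hn⟩ : ∃ n : Fin r, (n : ℕ) = (i : ℕ) + 1 :=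
        ⟨⟨i + 1, by have := Fin.lt_def.mp hij; omega⟩, rfl⟩
      have hle : σ j ≤ σ n := by
        have hnj : n ≤ j := Fin.le_def.mpr (by have := Fin.lt_def.mp hij; omega)
        rcases hnj.eq_or_lt with h | h
        · rw [h]
        · exact (hσdec _ _ h).le
      have h2 := hη2 i n hn
      rw [lt_div_iff₀ (pow_pos (hσpos i) 2)] at h2
      have h3 := mul_lt_mul_of_pos_left h2 hη
      have h4 := mul_le_mul_of_nonneg_left hle hη.le
      linarith
    have h := tendsto_normalized_iterate_one (x := fun δ t => lam i / σ i * a δ i t)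
      (hs i) (hs2 i) (hK i) (hs j) hgap (hx0 i) (hxrec i)
    have h' := h.const_mul (σ i / lam i)
    rw [mul_one] at h'
    exact h'.congr fun δ => (hscale i δ _).symm
end
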